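/- Let n ≥ 1 and let P, H, X be n × n complex matrices with P² = P. Define the current J := i(XH − HX), the time derivative of the state D := −i(HP − PH), and the spatial derivative G := i(XP − PX). Then Tr(J·P) = i·Tr( P·(D·G − G·D) ). (This is the finite-dimensional algebraic core of the identity 𝒯(J_k(t) P(t)) = i 𝒯( P(t) [∂_t P(t), ∇_k P(t)] ) expressing the current expectation value through the adiabatic curvature of the projection.) -/

import Mathlib

open Matrix

/-- For an idempotent `P`, compressing a product of two commutators with `P` kills all but
two of the four terms. -/
theorem IsIdempotentElem.mul_commutator_mul_commutator {R : Type*} [Ring R] {P : R}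
    (hP : IsIdempotentElem P) (A B : R) :
    P * ((A * P - P * A) * (B * P - P * B)) = P * A * P * B * P - P * A * B * P := by
  have h (Y : R) : P * (P * Y) = P * Y := by rw [← mul_assoc, hP.eq]
  simp only [mul_sub, sub_mul, mul_assoc, h]
  abel

/-- The trace of a compression by an idempotent matrix needs only one factor `P`. -/
theorem Matrix.trace_mul_mul_of_isIdempotentElem {n R : Type*} [Fintype n] [CommRing R]
    {P : Matrix n n R} (hP : IsIdempotentElem P) (A : Matrix n n R) :
    (P * A * P).trace = (A * P).trace := by
  rw [mul_assoc, trace_mul_comm, mul_assoc, hP.eq]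

/-- finite-dimensional algebraic core of the identity
`𝒯(J_k(t) P(t)) = i 𝒯(P(t) [∂_t P(t), ∇_k P(t)])`: for an idempotent `P` and matrices
`H`, `X`, with current `J = i[X,H]`, time derivative `D = -i[H,P]` and spatial
derivative `G = i[X,P]`, one has `Tr(J·P) = i·Tr(P·(D·G - G·D))`. -/
theorem trace_current_eq_adiabatic_curvature {n : ℕ} (hn : 1 ≤ n)
    (P H X : Matrix (Fin n) (Fin n) ℂ) (hP : P * P = P)
    (J D G : Matrix (Fin n) (Fin n) ℂ)
    (hJ : J = Complex.I • (X * H - H * X))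
    (hD : D = (-Complex.I) • (H * P - P * H))
    (hG : G = Complex.I • (X * P - P * X)) :
    (J * P).trace = Complex.I * (P * (D * G - G * D)).trace := by
  have hP' : IsIdempotentElem P := hP
  have hDG : D * G = (H * P - P * H) * (X * P - P * X) := by
    simp [hD, hG, smul_smul]
  have hGD : G * D = (X * P - P * X) * (H * P - P * H) := by
    simp [hD, hG, smul_smul]
  have hHX := trace_mul_mul_of_isIdempotentElem hP' (H * P * X)
  have hXH := trace_mul_mul_of_isIdempotentElem hP' (X * P * H)
  have hHX' := trace_mul_mul_of_isIdempotentElem hP' (H * X)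
  have hXH' := trace_mul_mul_of_isIdempotentElem hP' (X * H)
  have hcyc : (H * P * X * P).trace = (X * P * H * P).trace := by
    rw [mul_assoc, trace_mul_comm, ← mul_assoc]
  simp only [← mul_assoc] at hHX hXH hHX' hXH'
  rw [hDG, hGD, mul_sub, hP'.mul_commutator_mul_commutator,
    hP'.mul_commutator_mul_commutator, hJ]
  simp only [smul_mul, trace_smul, trace_sub, sub_mul, smul_eq_mul, hHX, hXH, hHX', hXH', hcyc]
  ring
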